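/- arXiv:2401.08948 — 4 statements merged into one kernel-verified Lean document; each statement's English description precedes it below -/
import Mathlib

section
/- Let t_0 ≤ t_1 ≤ … ≤ t_{m+k+1} be a nondecreasing knot sequence with m ≥ k ≥ 0, let p_0, …, p_m ∈ ℝ^n be control points, and let φ(t) = Σ_{i=0}^m p_i N_{i,k}(t) be the associated degree-k B-spline curve. Then for every t with t_k ≤ t < t_{m+1}, the point φ(t) lies in the convex hull of the control point set {p_0, …, p_m}. -/
/-- Cox–de Boor recursion for B-spline basis functions.
`bsplineBasis t k i x` is `N_{i,k}(x)` for knot sequence `t`.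
In Lean, division by zero is zero, so any term whose denominator vanishes is `0`,
matching the convention in the recursion. -/
noncomputable def bsplineBasis (t : ℕ → ℝ) : ℕ → ℕ → ℝ → ℝ
  | 0, i, x => if t i ≤ x ∧ x < t (i + 1) then 1 else 0
  | k + 1, i, x =>
      (x - t i) / (t (i + k + 1) - t i) * bsplineBasis t k i x +
      (t (i + k + 2) - x) / (t (i + k + 2) - t (i + 1)) * bsplineBasis t k (i + 1) x

lemma bspline_support (t : ℕ → ℝ) (ht : Monotone t) (x : ℝ) (k : ℕ) : ∀ i : ℕ,
    (x < t i ∨ t (i + k + 1) ≤ x) → bsplineBasis t k i x = 0 := by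
  induction k with
  | zero =>
    intro i h
    rw [bsplineBasis, if_neg]
    rintro ⟨h1, h2⟩
    rcases h with h | h
    · linarith
    · simp only [Nat.add_zero] at h
      linarith
  | succ k ih =>
    intro i h
    have m1 : t i ≤ t (i + 1) := ht (by omega)
    have m2 : t (i + k + 1) ≤ t (i + (k + 1) + 1) := ht (by omega)
    have e : i + 1 + k + 1 = i + (k + 1) + 1 := by omega
    rw [bsplineBasis, ih i, ih (i + 1)]
    · simp
    · rw [e]
      rcases h with h | h
      · left; linarith
      · right; exact h
    · rcases h with h | h
      · left; exact h
      · right; linarith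

lemma bspline_nonneg (t : ℕ → ℝ) (ht : Monotone t) (x : ℝ) (k : ℕ) : ∀ i : ℕ,
    0 ≤ bsplineBasis t k i x := by
  induction k with
  | zero =>
    intro i
    rw [bsplineBasis]
    split_ifs <;> norm_num
  | succ k ih =>
    intro i
    rw [bsplineBasis]
    have m1 : t i ≤ t (i + k + 1) := ht (by omega)
    have m2 : t (i + 1) ≤ t (i + k + 2) := ht (by omega)
    have e : i + 1 + k + 1 = i + k + 2 := by omega
    apply add_nonneg
    · by_cases h : x < t i
      · rw [bspline_support t ht x k i (Or.inl h)]; simp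
      · exact mul_nonneg (div_nonneg (by linarith) (by linarith)) (ih i)
    · by_cases h : t (i + k + 2) ≤ x
      · rw [bspline_support t ht x k (i + 1) (Or.inr (by rw [e]; exact h))]; simp
      · exact mul_nonneg (div_nonneg (by linarith) (by linarith)) (ih (i + 1))

lemma bspline_sum (t : ℕ → ℝ) (ht : Monotone t) (x : ℝ) (m : ℕ) (hx₂ : x < t (m + 1)) (k : ℕ) :
    t k ≤ x → ∑ i ∈ Finset.range (m + 1), bsplineBasis t k i x = 1 := by
  induction k with
  | zero =>
    intro h0
    have key : ∀ i, bsplineBasis t 0 i x =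
        (if t i ≤ x then (1 : ℝ) else 0) - (if t (i + 1) ≤ x then (1 : ℝ) else 0) := by
      intro i
      have := ht (Nat.le_succ i)
      rw [bsplineBasis]
      simp only [Nat.succ_eq_add_one] at this
      split_ifs <;> grind
    simp only [key]
    rw [Finset.sum_range_sub' (fun i => if t i ≤ x then (1 : ℝ) else 0)]
    simp [h0, hx₂]
  | succ k ih =>
    intro h
    have hk := ih (le_trans (ht (Nat.le_succ k)) h)
    let b : ℕ → ℝ := fun j => (t (j + k + 1) - x) / (t (j + k + 1) - t j) * bsplineBasis t k j x
    have key : ∀ i, bsplineBasis t (k + 1) i x = bsplineBasis t k i x + (b (i + 1) - b i) := by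
      intro i
      have e : i + 1 + k + 1 = i + k + 2 := by omega
      have m1 : t i ≤ t (i + k + 1) := ht (by omega)
      simp only [b, e]
      rw [bsplineBasis]
      rcases eq_or_lt_of_le m1 with h1 | h1
      · rw [bspline_support t ht x k i (by rw [← h1]; exact lt_or_ge _ _)]
        simp
      · have : t (i + k + 1) - t i ≠ 0 := by linarith
        have h2 : (x - t i) / (t (i + k + 1) - t i) =
            1 - (t (i + k + 1) - x) / (t (i + k + 1) - t i) := by
          field_simp
          ring
        rw [h2]
        ring
    simp only [key]
    rw [Finset.sum_add_distrib, hk, Finset.sum_range_sub]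
    have b1 : b (m + 1) = 0 := by
      simp only [b]
      rw [bspline_support t ht x k (m + 1) (Or.inl hx₂), mul_zero]
    have b0 : b 0 = 0 := by
      simp only [b]
      rw [bspline_support t ht x k 0 (Or.inr (by rw [Nat.zero_add]; exact h)), mul_zero]
    rw [b1, b0]
    simp


/-- Convex hull property: on the valid span `[t_k, t_{m+1})`, a degree-`k` B-spline curve
with control points `p_0, …, p_m ∈ ℝ^n` lies in the convex hull of its control points. -/
theorem bspline_curve_mem_convexHull (n : ℕ) (t : ℕ → ℝ) (ht : Monotone t) (k m : ℕ)
    (hkm : k ≤ m) (p : ℕ → (Fin n → ℝ)) (x : ℝ) (hx₁ : t k ≤ x) (hx₂ : x < t (m + 1)) :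
    (∑ i ∈ Finset.range (m + 1), bsplineBasis t k i x • p i) ∈
      convexHull ℝ (p '' Set.Iic m) := by
  refine (convex_convexHull ℝ _).sum_mem (fun i _ => bspline_nonneg t ht x k i)
    (bspline_sum t ht x m hx₂ k hx₁) (fun i hi => subset_convexHull ℝ _ ⟨i, ?_, rfl⟩)
  have := Finset.mem_range.1 hi
  exact Set.mem_Iic.2 (by omega)
end

section
/- Let t_0 ≤ t_1 ≤ … ≤ t_{m+k+1} be a nondecreasing knot sequence with m ≥ k ≥ 0, let p_0, …, p_m ∈ ℝ^n be control points, and let φ(t) = Σ_{i=0}^m p_i N_{i,k}(t). Then the curve locally lies in the convex hull of its active control points: for every index l with k ≤ l ≤ m and every t with t_l ≤ t < t_{l+1}, the point φ(t) lies in the convex hull of {p_{l−k}, p_{l−k+1}, …, p_l}. -/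
theorem bspline_aux_zero (t : ℕ → ℝ) (ht : Monotone t) (l : ℕ) (x : ℝ) (hx₁ : t l ≤ x)
    (hx₂ : x < t (l + 1)) (k : ℕ) : ∀ i, ¬ (i ≤ l ∧ l ≤ i + k) → bsplineBasis t k i x = 0 := by
  induction k with
  | zero =>
    intro i hi
    rw [bsplineBasis, if_neg]
    rintro ⟨h1, h2⟩
    rcases lt_trichotomy i l with h | h | h
    · have := ht (show i + 1 ≤ l by omega)
      linarith
    · omega
    · have := ht (show l + 1 ≤ i by omega)
      linarith
  | succ k ih =>
    intro i hi
    rw [bsplineBasis, ih i (by omega), ih (i + 1) (by omega)]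
    simp

theorem bspline_aux_nonneg (t : ℕ → ℝ) (ht : Monotone t) (l : ℕ) (x : ℝ) (hx₁ : t l ≤ x)
    (hx₂ : x < t (l + 1)) (k : ℕ) : ∀ i, 0 ≤ bsplineBasis t k i x := by
  induction k with
  | zero =>
    intro i
    rw [bsplineBasis]
    split_ifs <;> norm_num
  | succ k ih =>
    intro i
    rw [bsplineBasis]
    apply add_nonneg
    · by_cases h : i ≤ l ∧ l ≤ i + k
      · have h1 := ht h.1
        have h2 := ht (show i ≤ i + k + 1 by omega)
        exact mul_nonneg (div_nonneg (by linarith) (by linarith)) (ih i)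
      · rw [bspline_aux_zero t ht l x hx₁ hx₂ k i h, mul_zero]
    · by_cases h : i + 1 ≤ l ∧ l ≤ i + 1 + k
      · have h1 := ht (show l + 1 ≤ i + k + 2 by omega)
        have h2 := ht (show i + 1 ≤ i + k + 2 by omega)
        exact mul_nonneg (div_nonneg (by linarith) (by linarith)) (ih (i + 1))
      · rw [bspline_aux_zero t ht l x hx₁ hx₂ k (i + 1) h, mul_zero]

theorem bspline_aux_sum (t : ℕ → ℝ) (ht : Monotone t) (l : ℕ) (x : ℝ) (hx₁ : t l ≤ x)
    (hx₂ : x < t (l + 1)) (M : ℕ) (hM : l < M) (k : ℕ) (hk : k ≤ l) :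
    ∑ i ∈ Finset.range M, bsplineBasis t k i x = 1 := by
  induction k with
  | zero =>
    rw [Finset.sum_eq_single l]
    · rw [bsplineBasis, if_pos ⟨hx₁, hx₂⟩]
    · intro i _ hi
      exact bspline_aux_zero t ht l x hx₁ hx₂ 0 i (by omega)
    · intro h
      simp at h
      omega
  | succ k ih =>
    rw [← ih (by omega)]
    let b : ℕ → ℝ := fun j => (t (j + k + 1) - x) / (t (j + k + 1) - t j) * bsplineBasis t k j x
    have hb : ∑ i ∈ Finset.range M, b (i + 1) = ∑ i ∈ Finset.range M, b i := by
      have h1 := Finset.sum_range_succ' b M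
      rw [Finset.sum_range_succ] at h1
      have h0 : b 0 = 0 := by
        simp only [b]
        rw [bspline_aux_zero t ht l x hx₁ hx₂ k 0 (by omega), mul_zero]
      have h2 : b M = 0 := by
        simp only [b]
        rw [bspline_aux_zero t ht l x hx₁ hx₂ k M (by omega), mul_zero]
      linarith
    have hs : ∀ i, bsplineBasis t (k + 1) i x =
        (x - t i) / (t (i + k + 1) - t i) * bsplineBasis t k i x + b (i + 1) := by
      intro i
      rw [bsplineBasis]
      simp only [b]
      rw [show i + 1 + k + 1 = i + k + 2 by omega]
    rw [Finset.sum_congr rfl (fun i _ => hs i), Finset.sum_add_distrib, hb,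
      ← Finset.sum_add_distrib]
    refine Finset.sum_congr rfl fun i _ => ?_
    by_cases h : i ≤ l ∧ l ≤ i + k
    · have h1 := ht h.1
      have h2 := ht (show l + 1 ≤ i + k + 1 by omega)
      have h3 : t (i + k + 1) - t i ≠ 0 := by
        have : 0 < t (i + k + 1) - t i := by linarith
        exact this.ne'
      simp only [b]
      rw [← add_mul, ← add_div, show x - t i + (t (i + k + 1) - x) = t (i + k + 1) - t i by ring,
        div_self h3, one_mul]
    · simp only [b]
      rw [bspline_aux_zero t ht l x hx₁ hx₂ k i h]
      simp

/-- Local convex hull property: on a knot span `[t_l, t_{l+1})` with `k ≤ l ≤ m`, a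
degree-`k` B-spline curve lies in the convex hull of its active control points
`p_{l−k}, …, p_l`. -/
theorem bspline_curve_mem_convexHull_active (n : ℕ) (t : ℕ → ℝ) (ht : Monotone t)
    (k m : ℕ) (hkm : k ≤ m) (p : ℕ → (Fin n → ℝ)) (l : ℕ) (hkl : k ≤ l) (hlm : l ≤ m)
    (x : ℝ) (hx₁ : t l ≤ x) (hx₂ : x < t (l + 1)) :
    (∑ i ∈ Finset.range (m + 1), bsplineBasis t k i x • p i) ∈
      convexHull ℝ (p '' Set.Icc (l - k) l) := by
  have hsub : Finset.Icc (l - k) l ⊆ Finset.range (m + 1) := by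
    intro i hi
    simp only [Finset.mem_Icc, Finset.mem_range] at *
    omega
  have hz : ∀ i ∈ Finset.range (m + 1), i ∉ Finset.Icc (l - k) l → bsplineBasis t k i x = 0 := by
    intro i _ hi
    simp only [Finset.mem_Icc] at hi
    exact bspline_aux_zero t ht l x hx₁ hx₂ k i (by omega)
  rw [← Finset.sum_subset hsub (fun i h1 h2 => by rw [hz i h1 h2, zero_smul])]
  refine (convex_convexHull ℝ _).sum_mem
    (fun i _ => bspline_aux_nonneg t ht l x hx₁ hx₂ k i) ?_ ?_
  · rw [Finset.sum_subset hsub hz]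
    exact bspline_aux_sum t ht l x hx₁ hx₂ (m + 1) (by omega) k hkl
  · intro i hi
    exact subset_convexHull ℝ _ ⟨i, by simpa using hi, rfl⟩
end

section
/- Let the knot sequence be clamped at the left end: t_0 = t_1 = … = t_k < t_{k+1}, with m ≥ k ≥ 0 and control points p_0, …, p_m ∈ ℝ^n. Then the degree-k B-spline curve interpolates the first control point at the left endpoint: N_{0,k}(t_0) = 1, N_{i,k}(t_0) = 0 for all i ≥ 1, and hence φ(t_0) = p_0. -/
theorem bsplineBasis_clamped_aux (t : ℕ → ℝ) (ht : Monotone t) (k : ℕ)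
    (hclamp : ∀ j, j ≤ k → t j = t 0) (hnext : t k < t (k + 1)) (d : ℕ) :
    ∀ i, bsplineBasis t d i (t 0) = if i + d = k then 1 else 0 := by
  have h0 : t 0 < t (k + 1) := by rw [← hclamp k le_rfl]; exact hnext
  induction d with
  | zero =>
    intro i
    rw [bsplineBasis, add_zero]
    congr 1
    apply propext
    constructor
    · rintro ⟨h1, h2⟩
      rcases lt_trichotomy i k with h | h | h
      · have := hclamp (i + 1) h
        linarith
      · exact h
      · have : t (k + 1) ≤ t i := ht h
        linarith
    · rintro rfl
      exact ⟨(hclamp i le_rfl).le, h0⟩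
  | succ d ih =>
    intro i
    rw [bsplineBasis, ih, ih]
    have hA : (t 0 - t i) / (t (i + d + 1) - t i) * (if i + d = k then (1 : ℝ) else 0) = 0 := by
      split_ifs with h
      · rw [hclamp i (by omega)]
        simp
      · simp
    rw [hA, zero_add]
    by_cases h : i + (d + 1) = k
    · have h' : i + 1 + d = k := by omega
      have h2 : i + d + 2 = k + 1 := by omega
      rw [if_pos h, if_pos h', h2, hclamp (i + 1) (by omega), mul_one]
      exact div_self (sub_pos.2 h0).ne'
    · have h' : ¬ (i + 1 + d = k) := by omega
      rw [if_neg h, if_neg h', mul_zero]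

/-- For a knot vector clamped at the left end (`t_0 = t_1 = … = t_k < t_{k+1}`), the
degree-`k` B-spline curve interpolates the first control point at the left endpoint:
`N_{0,k}(t_0) = 1`, `N_{i,k}(t_0) = 0` for `i ≥ 1`, and hence `φ(t_0) = p_0`. -/
theorem bspline_clamped_left_endpoint (n : ℕ) (t : ℕ → ℝ) (ht : Monotone t) (k m : ℕ)
    (hkm : k ≤ m) (p : ℕ → (Fin n → ℝ))
    (hclamp : ∀ j, j ≤ k → t j = t 0) (hnext : t k < t (k + 1)) :
    bsplineBasis t k 0 (t 0) = 1 ∧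
    (∀ i, 1 ≤ i → bsplineBasis t k i (t 0) = 0) ∧
    (∑ i ∈ Finset.range (m + 1), bsplineBasis t k i (t 0) • p i) = p 0 := by
  have key := bsplineBasis_clamped_aux t ht k hclamp hnext k
  have h1 : bsplineBasis t k 0 (t 0) = 1 := by rw [key]; simp
  have h2 : ∀ i, 1 ≤ i → bsplineBasis t k i (t 0) = 0 := by
    intro i hi
    rw [key, if_neg (by omega)]
  refine ⟨h1, h2, ?_⟩
  rw [Finset.sum_eq_single 0]
  · rw [h1, one_smul]
  · intro i _ hi
    rw [h2 i (by omega), zero_smul]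
  · intro h
    simp at h
end

section
/- Let t_0 ≤ … ≤ t_{m+k+1} be a nondecreasing knot sequence with m ≥ k ≥ 1, let p_0, …, p_m ∈ ℝ^n, let φ(t) = Σ_{i=0}^m p_i N_{i,k}(t), and let q_i = (k/(t_{i+k+1} − t_{i+1}))(p_{i+1} − p_i) be the derivative control points. Suppose L ∈ ℝ^n with L ≥ 0 componentwise and |q_{i,ℓ}| ≤ L_ℓ for every i = 0, …, m−1 and every coordinate ℓ. Then the derivative of the curve obeys the same componentwise bound: for every t in the interior of a knot span (t_l, t_{l+1}) with k ≤ l ≤ m and t_l < t_{l+1}, |φ′(t)_ℓ| ≤ L_ℓ for every coordinate ℓ. (Bounding the derivative control points is a sufficient condition for bounding the curve's derivative.) -/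
theorem bs_supp (t : ℕ → ℝ) (ht : Monotone t) (x : ℝ) (k : ℕ) : ∀ i,
    (x < t i ∨ t (i + k + 1) ≤ x) → bsplineBasis t k i x = 0 := by
  induction k with
  | zero =>
    intro i h
    simp only [bsplineBasis]
    rw [if_neg]
    rintro ⟨h1, h2⟩
    rcases h with h | h
    · linarith
    · simp only [Nat.add_zero] at h
      linarith
  | succ k ih =>
    intro i h
    have h1 : t i ≤ t (i + 1) := ht (by omega)
    have h2 : t (i + k + 1) ≤ t (i + k + 2) := ht (by omega)
    have e1 : bsplineBasis t k i x = 0 := by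
      apply ih
      rcases h with h | h
      · exact Or.inl h
      · exact Or.inr (le_trans h2 h)
    have e2 : bsplineBasis t k (i + 1) x = 0 := by
      apply ih
      rcases h with h | h
      · exact Or.inl (lt_of_lt_of_le h h1)
      · right
        rw [show i + 1 + k + 1 = i + (k + 1) + 1 by omega]
        exact h
    simp [bsplineBasis, e1, e2]

theorem bs_nonneg (t : ℕ → ℝ) (ht : Monotone t) (x : ℝ) (k : ℕ) : ∀ i,
    0 ≤ bsplineBasis t k i x := by
  induction k with
  | zero =>
    intro i
    simp only [bsplineBasis]
    split_ifs <;> norm_num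
  | succ k ih =>
    intro i
    by_cases h : x < t i ∨ t (i + (k + 1) + 1) ≤ x
    · rw [bs_supp t ht x _ i h]
    · push Not at h
      obtain ⟨h1, h2⟩ := h
      rw [show i + (k + 1) + 1 = i + k + 2 by omega] at h2
      have h3 : t i ≤ t (i + k + 1) := ht (by omega)
      have h4 : t (i + 1) ≤ t (i + k + 2) := ht (by omega)
      simp only [bsplineBasis]
      exact add_nonneg (mul_nonneg (div_nonneg (by linarith) (by linarith)) (ih i))
        (mul_nonneg (div_nonneg (by linarith) (by linarith)) (ih (i + 1)))

theorem bs_left_le (t : ℕ → ℝ) (ht : Monotone t) (x : ℝ) (k i : ℕ) :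
    (x - t i) / (t (i + k + 1) - t i) * bsplineBasis t k i x ≤ bsplineBasis t k i x := by
  by_cases h : x < t i ∨ t (i + k + 1) ≤ x
  · rw [bs_supp t ht x _ i h]; simp
  · push Not at h
    have : (x - t i) / (t (i + k + 1) - t i) ≤ 1 :=
      div_le_one_of_le₀ (by linarith) (by linarith)
    exact mul_le_of_le_one_left (bs_nonneg t ht x k i) this

theorem bs_right_le (t : ℕ → ℝ) (ht : Monotone t) (x : ℝ) (k i : ℕ) :
    (t (i + k + 1) - x) / (t (i + k + 1) - t i) * bsplineBasis t k i x
      ≤ bsplineBasis t k i x := by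
  by_cases h : x < t i ∨ t (i + k + 1) ≤ x
  · rw [bs_supp t ht x _ i h]; simp
  · push Not at h
    have : (t (i + k + 1) - x) / (t (i + k + 1) - t i) ≤ 1 :=
      div_le_one_of_le₀ (by linarith) (by linarith)
    exact mul_le_of_le_one_left (bs_nonneg t ht x k i) this

theorem bs_both_le (t : ℕ → ℝ) (ht : Monotone t) (x : ℝ) (k i : ℕ) :
    (t (i + k + 1) - x) / (t (i + k + 1) - t i) * bsplineBasis t k i x +
    (x - t i) / (t (i + k + 1) - t i) * bsplineBasis t k i x ≤ bsplineBasis t k i x := by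
  rw [← add_mul, ← add_div]
  apply mul_le_of_le_one_left (bs_nonneg t ht x k i)
  rw [show t (i + k + 1) - x + (x - t i) = t (i + k + 1) - t i by ring]
  exact div_self_le_one _

theorem bs_sum_step (t : ℕ → ℝ) (ht : Monotone t) (x : ℝ) (k r : ℕ) :
    ∑ i ∈ Finset.range (r + 1), bsplineBasis t (k + 1) i x ≤
      ∑ i ∈ Finset.range (r + 1), bsplineBasis t k i x +
      (t (r + 1 + k + 1) - x) / (t (r + 1 + k + 1) - t (r + 1)) * bsplineBasis t k (r + 1) x := by
  induction r with
  | zero =>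
    have := bs_left_le t ht x k 0
    simp only [zero_add, Finset.sum_range_one, bsplineBasis] at this ⊢
    rw [show 1 + k + 1 = k + 2 by omega]
    linarith
  | succ r ih =>
    rw [Finset.sum_range_succ, Finset.sum_range_succ _ (r + 1)]
    have := bs_both_le t ht x k (r + 1)
    have e : bsplineBasis t (k + 1) (r + 1) x =
      (x - t (r + 1)) / (t (r + 1 + k + 1) - t (r + 1)) * bsplineBasis t k (r + 1) x +
      (t (r + 1 + k + 2) - x) / (t (r + 1 + k + 2) - t (r + 1 + 1)) *
        bsplineBasis t k (r + 1 + 1) x := by simp only [bsplineBasis]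
    rw [show r + 1 + 1 + k + 1 = r + 1 + k + 2 by omega]
    linarith

theorem bs_zero_eq (t : ℕ → ℝ) (ht : Monotone t) (l : ℕ) (x : ℝ)
    (hx : x ∈ Set.Ioo (t l) (t (l + 1))) (i : ℕ) :
    bsplineBasis t 0 i x = if i = l then 1 else 0 := by
  simp only [bsplineBasis]
  obtain ⟨h1, h2⟩ := hx
  by_cases h : i = l
  · subst h
    simp [h1.le, h2]
  · rw [if_neg h, if_neg]
    rintro ⟨h3, h4⟩
    rcases lt_or_gt_of_ne h with h | h
    · have : t (i + 1) ≤ t l := ht h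
      linarith
    · have : t (l + 1) ≤ t i := ht h
      linarith

theorem bs_sum_le (t : ℕ → ℝ) (ht : Monotone t) (l : ℕ) (x : ℝ)
    (hx : x ∈ Set.Ioo (t l) (t (l + 1))) (k : ℕ) : ∀ r,
    ∑ i ∈ Finset.range r, bsplineBasis t k i x ≤ 1 := by
  induction k with
  | zero =>
    intro r
    simp only [bs_zero_eq t ht l x hx, Finset.sum_ite_eq']
    split_ifs <;> norm_num
  | succ k ih =>
    intro r
    cases r with
    | zero => simp
    | succ r =>
      have h1 := bs_sum_step t ht x k r
      have h2 := bs_right_le t ht x k (r + 1)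
      have h3 := ih (r + 1 + 1)
      rw [Finset.sum_range_succ] at h3
      linarith

theorem bs_deriv (t : ℕ → ℝ) (ht : Monotone t) (l : ℕ) (x : ℝ)
    (hx : x ∈ Set.Ioo (t l) (t (l + 1))) (k : ℕ) : ∀ i,
    HasDerivAt (fun s => bsplineBasis t (k + 1) i s)
      (((k + 1 : ℕ) : ℝ) / (t (i + k + 1) - t i) * bsplineBasis t k i x -
        ((k + 1 : ℕ) : ℝ) / (t (i + k + 2) - t (i + 1)) * bsplineBasis t k (i + 1) x) x := by
  have key : ∀ (k i : ℕ) (d1 d2 : ℝ), HasDerivAt (fun s => bsplineBasis t k i s) d1 x →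
      HasDerivAt (fun s => bsplineBasis t k (i + 1) s) d2 x →
      HasDerivAt (fun s => bsplineBasis t (k + 1) i s)
        ((1 / (t (i + k + 1) - t i) * bsplineBasis t k i x +
          (x - t i) / (t (i + k + 1) - t i) * d1) +
         ((-1) / (t (i + k + 2) - t (i + 1)) * bsplineBasis t k (i + 1) x +
          (t (i + k + 2) - x) / (t (i + k + 2) - t (i + 1)) * d2)) x := by
    intro k i d1 d2 h1 h2
    simp only [bsplineBasis]
    exact ((((hasDerivAt_id x).sub_const (t i)).div_const _).mul h1).add
      ((((hasDerivAt_id x).const_sub (t (i + k + 2))).div_const _).mul h2)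
  induction k with
  | zero =>
    intro i
    have h0 : ∀ i, HasDerivAt (fun s => bsplineBasis t 0 i s) 0 x := by
      intro i
      apply (hasDerivAt_const x (if i = l then (1 : ℝ) else 0)).congr_of_eventuallyEq
      filter_upwards [isOpen_Ioo.mem_nhds hx] with s hs
      exact bs_zero_eq t ht l s hs i
    convert key 0 i 0 0 (h0 _) (h0 _) using 1
    push_cast
    ring
  | succ k ih =>
    intro i
    convert key (k + 1) i _ _ (ih i) (ih (i + 1)) using 1
    have e1 : i + (k + 1) + 1 = i + k + 2 := by omega
    have e2 : i + (k + 1) + 2 = i + k + 3 := by omega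
    have e3 : i + 1 + k + 1 = i + k + 2 := by omega
    have e4 : i + 1 + k + 2 = i + k + 3 := by omega
    have e5 : i + 1 + 1 = i + 2 := by omega
    simp only [bsplineBasis, e1, e2, e3, e4, e5]
    push_cast
    have m1 : t i ≤ t (i + 1) := ht (by omega)
    have m2 : t (i + 1) ≤ t (i + k + 2) := ht (by omega)
    have m3 : t (i + k + 2) ≤ t (i + k + 3) := ht (by omega)
    have hA : (t (i + k + 2) - t i) * (t (i + k + 2) - t i)⁻¹ *
        (t (i + k + 2) - t (i + 1))⁻¹ = (t (i + k + 2) - t (i + 1))⁻¹ := by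
      by_cases h : t (i + k + 2) - t i = 0
      · rw [show t (i + k + 2) - t (i + 1) = 0 by linarith]; simp
      · rw [mul_inv_cancel₀ h, one_mul]
    have hB : (t (i + k + 3) - t (i + 1)) * (t (i + k + 3) - t (i + 1))⁻¹ *
        (t (i + k + 2) - t (i + 1))⁻¹ = (t (i + k + 2) - t (i + 1))⁻¹ := by
      by_cases h : t (i + k + 3) - t (i + 1) = 0
      · rw [show t (i + k + 2) - t (i + 1) = 0 by linarith]; simp
      · rw [mul_inv_cancel₀ h, one_mul]
    simp only [div_eq_mul_inv]
    generalize (t (i + k + 2) - t i)⁻¹ = A at *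
    generalize (t (i + k + 3) - t (i + 1))⁻¹ = B at *
    generalize (t (i + k + 2) - t (i + 1))⁻¹ = b at *
    linear_combination ((k : ℝ) + 1) * bsplineBasis t k (i + 1) x * (hA - hB)

theorem bs_parts (a N : ℕ → ℝ) (p : ℕ → ℝ) (m : ℕ) :
    ∑ i ∈ Finset.range (m + 1), (a i * N i - a (i + 1) * N (i + 1)) * p i =
    a 0 * N 0 * p 0 - a (m + 1) * N (m + 1) * p m +
      ∑ i ∈ Finset.range m, a (i + 1) * (p (i + 1) - p i) * N (i + 1) := by
  induction m with
  | zero => simp; ring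
  | succ m ih => rw [Finset.sum_range_succ, ih, Finset.sum_range_succ _ m]; ring

/-- Bounding the derivative control points `q_i = (k/(t_{i+k+1} − t_{i+1})) • (p_{i+1} − p_i)`
componentwise by `L ≥ 0` is sufficient to bound the derivative of the B-spline curve
componentwise by `L` on the interior of each valid knot span `(t_l, t_{l+1})`, `k ≤ l ≤ m`. -/
theorem bspline_derivative_bound (n : ℕ) (t : ℕ → ℝ) (ht : Monotone t) (k m : ℕ)
    (hk : 1 ≤ k) (hkm : k ≤ m) (p : ℕ → (Fin n → ℝ)) (L : Fin n → ℝ)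
    (hL : ∀ ℓ, 0 ≤ L ℓ)
    (hq : ∀ i, i < m → ∀ ℓ : Fin n,
      |(((k : ℝ) / (t (i + k + 1) - t (i + 1))) • (p (i + 1) - p i)) ℓ| ≤ L ℓ)
    (l : ℕ) (hkl : k ≤ l) (hlm : l ≤ m) (hl : t l < t (l + 1))
    (x : ℝ) (hx : x ∈ Set.Ioo (t l) (t (l + 1)))
    (D : Fin n → ℝ)
    (hD : HasDerivAt (fun s => ∑ i ∈ Finset.range (m + 1), bsplineBasis t k i s • p i) D x) :
    ∀ ℓ : Fin n, |D ℓ| ≤ L ℓ := by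
  intro ℓ
  obtain ⟨k, rfl⟩ : ∃ j, k = j + 1 := ⟨k - 1, by omega⟩
  have h1 := (hasDerivAt_pi.1 hD) ℓ
  simp only [Finset.sum_apply, Pi.smul_apply, smul_eq_mul] at h1
  have h2 := HasDerivAt.fun_sum (u := Finset.range (m + 1)) fun i _ =>
    (bs_deriv t ht l x hx k i).mul_const (p i ℓ)
  have h3 := h1.unique h2
  have h4 := bs_parts (fun i => ((k + 1 : ℕ) : ℝ) / (t (i + k + 1) - t i))
    (fun i => bsplineBasis t k i x) (fun i => p i ℓ) m
  have e : ∀ i, i + 1 + k + 1 = i + k + 2 := fun i => by omega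
  simp only [e] at h4
  rw [h4] at h3
  obtain ⟨hx1, hx2⟩ := hx
  have z1 : bsplineBasis t k 0 x = 0 := by
    apply bs_supp t ht
    right
    have : t (0 + k + 1) ≤ t l := ht (by omega)
    linarith
  have z2 : bsplineBasis t k (m + 1) x = 0 := by
    apply bs_supp t ht
    left
    have : t (l + 1) ≤ t (m + 1) := ht (by omega)
    linarith
  rw [z1, z2] at h3
  simp only [mul_zero, zero_mul, sub_zero, zero_add] at h3
  rw [h3]
  have hs := bs_sum_le t ht l x ⟨hx1, hx2⟩ k (m + 1)
  rw [Finset.sum_range_succ', z1, add_zero] at hs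
  calc _ ≤ ∑ i ∈ Finset.range m, L ℓ * bsplineBasis t k (i + 1) x := by
        refine (Finset.abs_sum_le_sum_abs _ _).trans (Finset.sum_le_sum fun i hi => ?_)
        have hb := bs_nonneg t ht x k (i + 1)
        rw [abs_mul, abs_of_nonneg hb]
        exact mul_le_mul_of_nonneg_right (hq i (Finset.mem_range.1 hi) ℓ) hb
    _ = L ℓ * ∑ i ∈ Finset.range m, bsplineBasis t k (i + 1) x := by rw [Finset.mul_sum]
    _ ≤ L ℓ := mul_le_of_le_one_right (hL ℓ) hs
end
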